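/- arXiv:2007.11051 — 4 statements merged into one kernel-verified Lean document; each statement's English description precedes it below -/
import Mathlib

section
/- For every N ≥ 3, the number of D(C_N)-draconian sequences equals N·2^{N−2}, where C_N is the cycle graph on [N] (vertex i adjacent to i+1 for 1 ≤ i < N, and N adjacent to 1). Equivalently, NVol(∇^PQ_{C_N}) = N·2^{N−2}. -/
open Finset

attribute [local instance] Classical.propDecidable

/-- The set of neighbors of `i` in `G`, as a `Finset`. -/
noncomputable def nbr {N : ℕ} (G : SimpleGraph (Fin N)) (i : Fin N) : Finset (Fin N) :=
  Finset.univ.filter (fun j => G.Adj i j)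

/-- `(a 1, …, a N)` is a `D(G)`-draconian sequence: the entries sum to `N - 1` and for
every nonempty `S ⊆ [N]` one has `∑_{i ∈ S} a i < |S ∪ ⋃_{i ∈ S} N_G(i)|`. -/
def draconian {N : ℕ} (G : SimpleGraph (Fin N)) (a : Fin N → ℕ) : Prop :=
  (∑ i, a i) = N - 1 ∧
  ∀ S : Finset (Fin N), S.Nonempty →
    (∑ i ∈ S, a i) < (S ∪ S.biUnion (fun i => nbr G i)).card

/-- The cycle graph on `[N]`: vertex `i` adjacent to `i + 1` for `1 ≤ i < N`,
and `N` adjacent to `1` (here with `0`-indexed vertices `Fin N`). -/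
def cycleG (N : ℕ) : SimpleGraph (Fin N) :=
  SimpleGraph.fromRel (fun i j => (j : ℕ) = (i : ℕ) + 1 ∨ ((i : ℕ) = 0 ∧ (j : ℕ) = N - 1))

open scoped Fin.CommRing

section Cyclic

variable {N : ℕ} [NeZero N]

lemma Fin.eq_add_one_iff_val (hN : 2 ≤ N) (i j : Fin N) :
    j = i + 1 ↔ (j : ℕ) = i + 1 ∨ ((i : ℕ) = N - 1 ∧ (j : ℕ) = 0) := by
  obtain ⟨n, rfl⟩ : ∃ n, N = n + 2 := ⟨N - 2, by omega⟩
  have hi := i.isLt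
  have hj := j.isLt
  rw [Fin.ext_iff, Fin.val_add, Fin.val_one]
  by_cases h : (i : ℕ) = n + 1
  · rw [h, Nat.mod_self]; omega
  · rw [Nat.mod_eq_of_lt (by omega)]; omega

lemma cycleG_adj (hN : 3 ≤ N) (i j : Fin N) :
    (cycleG N).Adj i j ↔ j = i + 1 ∨ i = j + 1 := by
  have hi := i.isLt
  have hj := j.isLt
  rw [Fin.eq_add_one_iff_val (by omega), Fin.eq_add_one_iff_val (by omega), cycleG,
    SimpleGraph.fromRel_adj, Ne, Fin.ext_iff]
  omega

lemma mem_closedNbr_cycleG (hN : 3 ≤ N) (S : Finset (Fin N)) (j : Fin N) :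
    j ∈ S ∪ S.biUnion (fun i => nbr (cycleG N) i) ↔ j ∈ S ∨ j - 1 ∈ S ∨ j + 1 ∈ S := by
  simp only [mem_union, mem_biUnion, nbr, mem_filter, mem_univ, true_and, cycleG_adj hN]
  constructor
  · rintro (h | ⟨i, hi, rfl | rfl⟩)
    · exact .inl h
    · simp [hi]
    · exact .inr (.inr hi)
  · rintro (h | h | h)
    · exact .inl h
    · exact .inr ⟨_, h, .inl (by simp)⟩
    · exact .inr ⟨_, h, .inr rfl⟩

lemma Fin.exists_eq_add_natCast (m i : Fin N) : ∃ t < N, i = m + (t : Fin N) :=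
  ⟨(i - m).val, (i - m).isLt, by rw [Fin.cast_val_eq_self]; abel⟩

lemma Fin.forall_of_add_one {p : Fin N → Prop} (m : Fin N) (h0 : p m)
    (hs : ∀ i, p i → p (i + 1)) (i : Fin N) : p i := by
  have h : ∀ t : ℕ, p (m + (t : Fin N)) := by
    intro t
    induction t with
    | zero => simpa using h0
    | succ t ih => simpa [add_assoc] using hs _ ih
  obtain ⟨t, -, rfl⟩ := Fin.exists_eq_add_natCast m i
  exact h t

lemma Fin.natCast_inj_of_lt {s t : ℕ} (hs : s < N) (ht : t < N)
    (h : (s : Fin N) = (t : Fin N)) : s = t := by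
  have := congrArg Fin.val h
  rwa [Fin.val_cast_of_lt hs, Fin.val_cast_of_lt ht] at this

lemma Fin.sum_range_add_natCast {M : Type*} [AddCommMonoid M] (f : Fin N → M) (m : Fin N) :
    ∑ t ∈ range N, f (m + (t : Fin N)) = ∑ i, f i := by
  rw [← Fin.sum_univ_eq_sum_range (fun t => f (m + (t : Fin N)))]
  simp only [Fin.cast_val_eq_self]
  exact Equiv.sum_comp (Equiv.addLeft m) f

/-- The sequence attached to a position `k` and a set `T` avoiding `k` and `k + 1`: its
entries minus one are the cyclic increments of the indicator of `T`, lowered by one at `k`. -/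
noncomputable def cycleSeq (k : Fin N) (T : Finset (Fin N)) (i : Fin N) : ℕ :=
  (if i ∈ insert k T then 0 else 1) + if i + 1 ∈ T then 1 else 0

lemma sum_cycleSeq (k : Fin N) (T S : Finset (Fin N)) :
    ∑ i ∈ S, cycleSeq k T i = #(S \ insert k T) + #{j ∈ T | j - 1 ∈ S} := by
  have h : #{i ∈ S | i + 1 ∈ T} = #{j ∈ T | j - 1 ∈ S} := by
    refine card_bij' (fun i _ => i + 1) (fun j _ => j - 1) ?_ ?_ ?_ ?_ <;>
      simp +contextual
  simp only [cycleSeq, sum_add_distrib]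
  rw [← h, card_filter, sdiff_eq_filter, card_filter]
  congr 1
  exact sum_congr rfl fun i _ => by split_ifs <;> simp_all

lemma draconian_cycleSeq (hN : 3 ≤ N) {k : Fin N} {T : Finset (Fin N)} (hk : k ∉ T) :
    draconian (cycleG N) (cycleSeq k T) := by
  refine ⟨?_, fun S hS => ?_⟩
  · have h := card_sdiff_add_card_eq_card (subset_univ (insert k T))
    rw [card_insert_of_notMem hk, card_univ, Fintype.card_fin] at h
    rw [sum_cycleSeq]
    simp only [mem_univ, filter_true]
    omega
  · have hdisj : Disjoint (S \ insert k T) {j ∈ T | j - 1 ∈ S} := by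
      rw [disjoint_left]
      intro i hi hi'
      simp_all
    rw [sum_cycleSeq, ← card_union_of_disjoint hdisj]
    refine card_lt_card (Finset.ssubset_iff_subset_ne.2 ⟨fun j hj => ?_, fun heq => ?_⟩)
    · rw [mem_closedNbr_cycleG hN]
      simp only [mem_union, mem_sdiff, mem_filter] at hj
      tauto
    have key : ∀ j, (j ∈ S ∨ j - 1 ∈ S ∨ j + 1 ∈ S) →
        (j ∈ S ∧ j ∉ insert k T) ∨ (j ∈ T ∧ j - 1 ∈ S) := by
      intro j hj
      rw [← mem_closedNbr_cycleG hN, ← heq] at hj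
      simpa only [mem_union, mem_sdiff, mem_filter] using hj
    have hkS : k ∉ S ∧ k + 1 ∉ S := by
      have := key k
      simp only [mem_insert, true_or, not_true_eq_false, and_false, false_or, hk,
        false_and] at this
      tauto
    have hwalk := Fin.forall_of_add_one (p := fun i => i ∉ S ∧ i + 1 ∉ S) k hkS
      (fun i hi => ⟨hi.2, fun h => by
        have := key (i + 1) (.inr (.inr h))
        rw [add_sub_cancel_right] at this
        tauto⟩)
    obtain ⟨i, hi⟩ := hS
    exact (hwalk i).1 hi

lemma cycleSeq_inj {k k' : Fin N} {T T' : Finset (Fin N)} (hk : k ∉ T) (hk1 : k + 1 ∉ T)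
    (hk' : k' ∉ T') (hk1' : k' + 1 ∉ T') (h : cycleSeq k T = cycleSeq k' T') :
    k = k' ∧ T = T' := by
  have heq : ∀ i, cycleSeq k T i = cycleSeq k' T' i := fun i => congrFun h i
  simp only [cycleSeq, mem_insert] at heq
  have hT : ∀ i, (i ∈ T ↔ i ∈ T') := by
    refine Fin.forall_of_add_one (k + 1) ?_ ?_
    · have := heq k
      by_cases hkk : k = k'
      · subst hkk; tauto
      · simp only [true_or, if_true, hk1, if_false, hkk, false_or] at this
        by_cases h2 : k + 1 ∈ T'
        · simp [h2] at this
        · tauto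
    · intro i hi
      have := heq i
      by_cases h1 : i = k <;> by_cases h2 : i = k' <;> by_cases h3 : i ∈ T' <;>
        by_cases h4 : i + 1 ∈ T <;> by_cases h5 : i + 1 ∈ T' <;> simp_all
  have hTT : T = T' := Finset.ext hT
  subst hTT
  refine ⟨?_, rfl⟩
  by_contra hkk
  have := heq k
  simp [hk, hk1, hkk] at this

lemma draconian.sum_range_le (hN : 3 ≤ N) {a : Fin N → ℕ} (ha : draconian (cycleG N) a)
    (m : Fin N) {t : ℕ} (ht : t ≤ N) :
    ∑ x ∈ range t, a (m + (x : Fin N)) ≤ t + 1 := by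
  rcases t.eq_zero_or_pos with rfl | ht0
  · simp
  have hinj : Set.InjOn (fun x : ℕ => m + (x : Fin N)) (range t) := by
    intro x hx y hy hxy
    simp only [coe_range, Set.mem_Iio] at hx hy
    exact Fin.natCast_inj_of_lt (by omega) (by omega) (add_left_cancel hxy)
  have h := ha.2 ((range t).image fun x : ℕ => m + (x : Fin N))
    (Nonempty.image (nonempty_range_iff.2 ht0.ne') _)
  rw [sum_image hinj] at h
  have hsub : ((range t).image fun x : ℕ => m + (x : Fin N)) ∪
      ((range t).image fun x : ℕ => m + (x : Fin N)).biUnion (fun i => nbr (cycleG N) i) ⊆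
      (range (t + 2)).image fun x : ℕ => m - 1 + (x : Fin N) := by
    intro j hj
    rw [mem_closedNbr_cycleG hN] at hj
    simp only [mem_image, mem_range] at hj ⊢
    rcases hj with ⟨x, hx, h⟩ | ⟨x, hx, h⟩ | ⟨x, hx, h⟩
    · exact ⟨x + 1, by omega, by rw [← h]; push_cast; ring⟩
    · refine ⟨x + 2, by omega, ?_⟩
      rw [← sub_add_cancel j 1, ← h]; push_cast; ring
    · refine ⟨x, by omega, ?_⟩
      rw [← add_sub_cancel_right j 1, ← h]; ring
  have hc := (card_le_card hsub).trans card_image_le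
  rw [card_range] at hc
  omega

/-- A cycle lemma: a cyclic integer sequence of total `-1` has a starting point from which
all proper partial sums are nonnegative. -/
lemma Fin.exists_forall_sum_range_nonneg {b : Fin N → ℤ} (hb : ∑ i, b i = -1) :
    ∃ m : Fin N, ∀ t < N, 0 ≤ ∑ x ∈ range t, b (m + (x : Fin N)) := by
  set P : ℕ → ℤ := fun j => ∑ x ∈ range j, b (x : Fin N) with hP
  have hadd : ∀ j t, P (j + t) = P j + ∑ x ∈ range t, b ((j : Fin N) + (x : Fin N)) := by
    intro j t
    simp only [hP, sum_range_add, Nat.cast_add]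
  have hper : Function.Periodic (fun j : ℕ => N * P j + j) N := by
    intro j
    simp only [hadd, Fin.sum_range_add_natCast, hb]
    push_cast
    ring
  obtain ⟨m, -, hm⟩ := exists_min_image (range N) (fun j : ℕ => N * P j + j)
    (nonempty_range_iff.2 (NeZero.ne N))
  refine ⟨(m : Fin N), fun t ht => ?_⟩
  have h := hm ((m + t) % N) (mem_range.2 (Nat.mod_lt _ (NeZero.pos N)))
  have hmod : (N * P ((m + t) % N) + ((m + t) % N : ℕ) : ℤ) = N * P (m + t) + (m + t : ℕ) :=
    hper.map_mod_nat (m + t)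
  rw [hmod, hadd] at h
  push_cast at h
  by_contra! hneg
  have : (t : ℤ) < N := by exact_mod_cast ht
  nlinarith

lemma draconian.exists_cycleSeq (hN : 3 ≤ N) {a : Fin N → ℕ} (ha : draconian (cycleG N) a) :
    ∃ k T, k ∉ T ∧ k + 1 ∉ T ∧ cycleSeq k T = a := by
  have hb : ∑ i, ((a i : ℤ) - 1) = -1 := by
    rw [sum_sub_distrib, ← Nat.cast_sum, ha.1]
    simp only [sum_const, card_univ, Fintype.card_fin, nsmul_eq_mul, mul_one]
    omega
  obtain ⟨m, hm⟩ := Fin.exists_forall_sum_range_nonneg hb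
  set Q : ℕ → ℤ := fun t => ∑ x ∈ range t, ((a (m + (x : Fin N)) : ℤ) - 1) with hQ
  replace hm : ∀ t < N, 0 ≤ Q t := hm
  have hle : ∀ t < N, Q t ≤ 1 := by
    intro t ht
    have h := ha.sum_range_le hN m ht.le
    have : Q t = (∑ x ∈ range t, a (m + (x : Fin N)) : ℕ) - t := by
      simp [hQ]
    omega
  have hsucc : ∀ t, Q (t + 1) = Q t + (a (m + (t : Fin N)) - 1) := fun t => sum_range_succ _ _
  have hQN : Q N = -1 := by
    rw [← hb]
    exact Fin.sum_range_add_natCast (fun i => (a i : ℤ) - 1) m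
  have hQ0 : Q 0 = 0 := sum_range_zero _
  set T : Finset (Fin N) := {i | Q (i - m).val = 1} with hT
  have hmem : ∀ t < N, (m + (t : Fin N) ∈ T ↔ Q t = 1) := by
    intro t ht
    simp [hT, Fin.val_cast_of_lt ht]
  have hmT : m ∉ T := by
    have := hmem 0 (by omega)
    simp_all
  have hk1 : m + ((N - 1 : ℕ) : Fin N) + 1 = m := by
    rw [add_assoc, ← Nat.cast_add_one, Nat.sub_add_cancel (by omega), Fin.natCast_self, add_zero]
  have hlast := hsucc (N - 1)
  rw [Nat.sub_add_cancel (by omega), hQN] at hlast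
  have hQlast := hm (N - 1) (by omega)
  refine ⟨m + ((N - 1 : ℕ) : Fin N), T, ?_, by rwa [hk1], funext fun i => ?_⟩
  · rw [hmem _ (by omega)]
    omega
  obtain ⟨t, ht, rfl⟩ := Fin.exists_eq_add_natCast m i
  simp only [cycleSeq, mem_insert, hmem t ht]
  by_cases htN : t = N - 1
  · subst htN
    rw [hk1, if_pos (.inl rfl), if_neg hmT]
    omega
  · have hne : m + (t : Fin N) ≠ m + ((N - 1 : ℕ) : Fin N) := fun h =>
      htN (Fin.natCast_inj_of_lt ht (by omega) (add_left_cancel h))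
    have hmem1 : m + (t : Fin N) + 1 ∈ T ↔ Q (t + 1) = 1 := by
      rw [add_assoc, ← Nat.cast_add_one, hmem (t + 1) (by omega)]
    have h0 := hm t ht
    have h1 := hle t ht
    have h2 := hm (t + 1) (by omega)
    have h3 := hle (t + 1) (by omega)
    have h4 := hsucc t
    simp only [hne, false_or, hmem1]
    split_ifs <;> omega

end Cyclic

/-- For every `N ≥ 3`, the number of `D(C_N)`-draconian sequences equals `N * 2 ^ (N - 2)`. -/
theorem ncard_draconian_cycle {N : ℕ} (hN : 3 ≤ N) :
    {a : Fin N → ℕ | draconian (cycleG N) a}.ncard = N * 2 ^ (N - 2) := by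
  have : NeZero N := ⟨by omega⟩
  set A : Finset (Σ _ : Fin N, Finset (Fin N)) :=
    univ.sigma fun k => (univ \ {k, k + 1}).powerset with hA
  have hmem : ∀ p, p ∈ A ↔ p.1 ∉ p.2 ∧ p.1 + 1 ∉ p.2 := by
    intro p
    simp only [hA, mem_sigma, mem_univ, true_and, mem_powerset, subset_sdiff, subset_univ,
      disjoint_insert_right, disjoint_singleton_right]
  have hset : {a : Fin N → ℕ | draconian (cycleG N) a} =
      (A.image fun p => cycleSeq p.1 p.2 : Finset (Fin N → ℕ)) := by
    ext a
    simp only [Set.mem_ofPred_eq, coe_image, Set.mem_image, mem_coe, hmem]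
    constructor
    · intro ha
      obtain ⟨k, T, hk, hk1, h⟩ := ha.exists_cycleSeq hN
      exact ⟨⟨k, T⟩, ⟨hk, hk1⟩, h⟩
    · rintro ⟨p, hp, rfl⟩
      exact draconian_cycleSeq hN hp.1
  have hinj : Set.InjOn (fun p : Σ _ : Fin N, Finset (Fin N) => cycleSeq p.1 p.2) A := by
    rintro ⟨k, T⟩ hp ⟨k', T'⟩ hp' h
    rw [mem_coe, hmem] at hp hp'
    obtain ⟨rfl, rfl⟩ := cycleSeq_inj hp.1 hp.2 hp'.1 hp'.2 h
    rfl
  have hcard : ∀ k : Fin N, #(univ \ {k, k + 1}) = N - 2 := by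
    intro k
    have hne : k ≠ k + 1 := by
      rw [Ne, Fin.eq_add_one_iff_val (by omega)]
      omega
    rw [card_sdiff_of_subset (subset_univ _), card_pair hne, card_univ, Fintype.card_fin]
  rw [hset, Set.ncard_coe_finset, card_image_of_injOn hinj, hA, card_sigma]
  simp [card_powerset, hcard]
end

section
/- Let G be a connected simple graph on [N] and let e = uv be any edge of G. If (c_1,…,c_N) is a D(G)-draconian sequence, then (c_1,…,c_N,1) is a D(G△e)-draconian sequence. Moreover, the map c ↦ (c,1) is an injection from 𝔇(G) into 𝔇(G△e). -/
open Finset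

attribute [local instance] Classical.propDecidable

/-- The subdivision `G : e` of the edge `e = uv` of `G`: the graph on `[N+1]` with edge
set `(E(G) ∖ {uv}) ∪ {u(N+1), v(N+1)}`. -/
def subdiv {N : ℕ} (G : SimpleGraph (Fin N)) (u v : Fin N) : SimpleGraph (Fin (N + 1)) :=
  SimpleGraph.fromRel (fun i j =>
    (∃ a b : Fin N, i = a.castSucc ∧ j = b.castSucc ∧ G.Adj a b ∧
      ¬(a = u ∧ b = v) ∧ ¬(a = v ∧ b = u))
    ∨ (i = u.castSucc ∧ j = Fin.last N) ∨ (i = v.castSucc ∧ j = Fin.last N))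

/-- The graph `G △ e` for an edge `e = uv` of `G`: the graph on `[N+1]` with edge set
`E(G) ∪ {u(N+1), v(N+1)}`. -/
def triExt {N : ℕ} (G : SimpleGraph (Fin N)) (u v : Fin N) : SimpleGraph (Fin (N + 1)) :=
  SimpleGraph.fromRel (fun i j =>
    (∃ a b : Fin N, i = a.castSucc ∧ j = b.castSucc ∧ G.Adj a b)
    ∨ (i = u.castSucc ∧ j = Fin.last N) ∨ (i = v.castSucc ∧ j = Fin.last N))

/-- A graph on `[N]` is `2`-connected if it has at least `3` vertices, is connected, and
remains connected after deleting any single vertex. -/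
def TwoConnected {N : ℕ} (G : SimpleGraph (Fin N)) : Prop :=
  3 ≤ N ∧ G.Connected ∧
    ∀ v : Fin N, (G.comap (fun u : {w : Fin N // w ≠ v} => (u : Fin N))).Connected

theorem triExt_adj_castSucc {N : ℕ} {G : SimpleGraph (Fin N)} (u v : Fin N) {a b : Fin N}
    (h : G.Adj a b) : (triExt G u v).Adj a.castSucc b.castSucc := by
  refine (SimpleGraph.fromRel_adj _ _ _).2 ⟨fun hab => h.ne (Fin.castSucc_injective N hab), ?_⟩
  exact Or.inl (Or.inl ⟨a, b, rfl, rfl, h⟩)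

theorem triExt_adj_last_left {N : ℕ} (G : SimpleGraph (Fin N)) (u v : Fin N) :
    (triExt G u v).Adj (Fin.last N) u.castSucc :=
  (SimpleGraph.fromRel_adj _ _ _).2
    ⟨(Fin.castSucc_lt_last u).ne', Or.inr (Or.inr (Or.inl ⟨rfl, rfl⟩))⟩

theorem triExt_adj_last_right {N : ℕ} (G : SimpleGraph (Fin N)) (u v : Fin N) :
    (triExt G u v).Adj (Fin.last N) v.castSucc :=
  (SimpleGraph.fromRel_adj _ _ _).2
    ⟨(Fin.castSucc_lt_last v).ne', Or.inr (Or.inr (Or.inr ⟨rfl, rfl⟩))⟩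

theorem mem_closedNbr {N : ℕ} (G : SimpleGraph (Fin N)) (S : Finset (Fin N)) (j : Fin N) :
    j ∈ S ∪ S.biUnion (fun i => nbr G i) ↔ j ∈ S ∨ ∃ i ∈ S, G.Adj i j := by
  simp [nbr]

/-- The vertices of `S` other than the last one, as vertices of the smaller graph. -/
noncomputable def castSuccPreimage {N : ℕ} (S : Finset (Fin (N + 1))) : Finset (Fin N) :=
  Finset.univ.filter (fun i => i.castSucc ∈ S)

theorem mem_castSuccPreimage {N : ℕ} (S : Finset (Fin (N + 1))) (i : Fin N) :
    i ∈ castSuccPreimage S ↔ i.castSucc ∈ S := by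
  simp [castSuccPreimage]

theorem sum_snoc_eq {N : ℕ} (S : Finset (Fin (N + 1))) (c : Fin N → ℕ) (x : ℕ) :
    ∑ i ∈ S, (Fin.snoc c x : Fin (N + 1) → ℕ) i =
      ∑ i ∈ castSuccPreimage S, c i + if Fin.last N ∈ S then x else 0 := by
  have h : S = Finset.univ.filter (· ∈ S) := by simp
  conv_lhs => rw [h, Finset.sum_filter, Fin.sum_univ_castSucc]
  simp [castSuccPreimage, Finset.sum_filter]

/-- The closed neighborhood in `G △ e` contains that in `G`. -/
theorem map_closedNbr_subset {N : ℕ} (G : SimpleGraph (Fin N)) (u v : Fin N)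
    (S : Finset (Fin (N + 1))) :
    (castSuccPreimage S ∪ (castSuccPreimage S).biUnion (fun i => nbr G i)).map
      Fin.castSuccEmb ⊆ S ∪ S.biUnion (fun i => nbr (triExt G u v) i) := by
  intro j hj
  obtain ⟨k, hk, rfl⟩ := Finset.mem_map.1 hj
  rw [mem_closedNbr] at hk ⊢
  rcases hk with hk | ⟨i, hi, hik⟩
  · exact Or.inl ((mem_castSuccPreimage S k).1 hk)
  · exact Or.inr ⟨i.castSucc, (mem_castSuccPreimage S i).1 hi, triExt_adj_castSucc u v hik⟩

/-- Let `G` be connected on `[N]` and let `e = uv` be any edge. If `c` is `D(G)`-draconian,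
then `(c, 1)` is `D(G△e)`-draconian; moreover, `c ↦ (c, 1)` is an injection from `𝔇(G)`
into `𝔇(G△e)`. -/
theorem draconian_snoc_one_triExt {N : ℕ} (G : SimpleGraph (Fin N)) (hconn : G.Connected)
    (u v : Fin N) (he : G.Adj u v) :
    (∀ c : Fin N → ℕ, draconian G c → draconian (triExt G u v) (Fin.snoc c 1)) ∧
    Set.InjOn (fun c : Fin N → ℕ => (Fin.snoc c 1 : Fin (N + 1) → ℕ))
      {a | draconian G a} := by
  refine ⟨fun c hc => ⟨?_, fun S hS => ?_⟩, fun a _ b _ hab => (Fin.snoc_injective2 hab).1⟩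
  · have hN : 0 < N := u.pos
    simp only [Fin.sum_univ_castSucc, Fin.snoc_castSucc, Fin.snoc_last, hc.1]
    omega
  · have hsub := map_closedNbr_subset G u v S
    rw [sum_snoc_eq]
    rcases (castSuccPreimage S).eq_empty_or_nonempty with hT | hT
    · have hlast : Fin.last N ∈ S := by
        obtain ⟨i, hi⟩ := hS
        induction i using Fin.lastCases with
        | last => exact hi
        | cast i =>
          have := (mem_castSuccPreimage S i).2 hi
          simp [hT] at this
      rw [hT, Finset.sum_empty, if_pos hlast, zero_add]
      exact Finset.one_lt_card.2
        ⟨_, (mem_closedNbr _ _ _).2 (Or.inr ⟨_, hlast, triExt_adj_last_left G u v⟩),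
          _, (mem_closedNbr _ _ _).2 (Or.inr ⟨_, hlast, triExt_adj_last_right G u v⟩),
          fun h => he.ne (Fin.castSucc_injective N h)⟩
    · have hlt := hc.2 _ hT
      rw [← Finset.card_map Fin.castSuccEmb] at hlt
      split_ifs with hlast
      · refine (Nat.add_lt_add_right hlt 1).trans_le ?_
        rw [← Finset.card_insert_of_notMem (a := Fin.last N)]
        · exact Finset.card_le_card
            (Finset.insert_subset (Finset.mem_union_left _ hlast) hsub)
        · intro h
          obtain ⟨k, -, hk⟩ := Finset.mem_map.1 h
          exact (Fin.castSucc_lt_last k).ne hk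
      · exact hlt.trans_le (Finset.card_le_card hsub)
end

section
/- Let G be a 2-connected simple graph on [N] with an edge e = uv such that deg_G(u) = 2, and let d = (d_1,…,d_{N+1}) be a D(G:e)-draconian sequence. If d_{N+1} = 1, then (d_1,…,d_N) is a D(G)-draconian sequence. If d_{N+1} = 2, then the sequence obtained from (d_1,…,d_N) by increasing the entry d_u by 1 is a D(G)-draconian sequence. -/
open Finset

attribute [local instance] Classical.propDecidable

/-- If `d` is `G:e`-draconian, a set avoiding both ends of `e = uv` has small sum in `G`. -/
theorem sum_castSucc_lt_of_notMem {N : ℕ} {G : SimpleGraph (Fin N)} {u v : Fin N}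
    {d : Fin (N + 1) → ℕ} (hd : draconian (subdiv G u v) d) {S : Finset (Fin N)}
    (hS : S.Nonempty) (hu : u ∉ S) (hv : v ∉ S) :
    ∑ i ∈ S, d i.castSucc < (S ∪ S.biUnion (fun i => nbr G i)).card := by
  have h := hd.2 (S.map Fin.castSuccEmb) (hS.map)
  rw [Finset.sum_map] at h
  refine h.trans_le ?_
  rw [← Finset.card_map Fin.castSuccEmb (s := S ∪ S.biUnion (fun i => nbr G i))]
  refine Finset.card_le_card fun j hj => ?_
  simp only [mem_union, mem_biUnion, mem_map, nbr, mem_filter, mem_univ, true_and, subdiv,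
    SimpleGraph.fromRel_adj, Fin.castSuccEmb_apply] at hj ⊢
  rcases hj with ⟨i, hi, rfl⟩ | ⟨_, ⟨i, hi, rfl⟩, -, hadj⟩
  · exact ⟨i, Or.inl hi, rfl⟩
  · rcases hadj with (⟨a, b, ha, rfl, hab, -⟩ | ⟨ha, -⟩ | ⟨ha, -⟩) |
      (⟨a, b, rfl, hb, hab, -⟩ | ⟨-, hb⟩ | ⟨-, hb⟩)
    · obtain rfl := Fin.castSucc_injective _ ha
      exact ⟨b, Or.inr ⟨i, hi, hab⟩, rfl⟩
    · exact absurd (Fin.castSucc_injective _ ha ▸ hi) hu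
    · exact absurd (Fin.castSucc_injective _ ha ▸ hi) hv
    · obtain rfl := Fin.castSucc_injective _ hb
      exact ⟨a, Or.inr ⟨i, hi, hab.symm⟩, rfl⟩
    · exact absurd hb (Fin.castSucc_ne_last i)
    · exact absurd hb (Fin.castSucc_ne_last i)

/-- If `d` is `G:e`-draconian, a set meeting `e = uv` can absorb the entry of `d` at the new
vertex. -/
theorem sum_castSucc_add_last_le_of_mem {N : ℕ} {G : SimpleGraph (Fin N)} {u v : Fin N}
    (he : G.Adj u v) {d : Fin (N + 1) → ℕ} (hd : draconian (subdiv G u v) d)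
    {S : Finset (Fin N)} (huv : u ∈ S ∨ v ∈ S) :
    ∑ i ∈ S, d i.castSucc + d (Fin.last N) ≤ (S ∪ S.biUnion (fun i => nbr G i)).card := by
  have hlast : Fin.last N ∉ S.map Fin.castSuccEmb := by
    simp [Fin.castSucc_ne_last]
  have h := hd.2 (insert (Fin.last N) (S.map Fin.castSuccEmb)) (insert_nonempty _ _)
  rw [Finset.sum_insert hlast, Finset.sum_map] at h
  have hsub : insert (Fin.last N) (S.map Fin.castSuccEmb) ∪
      (insert (Fin.last N) (S.map Fin.castSuccEmb)).biUnion (fun i => nbr (subdiv G u v) i) ⊆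
      insert (Fin.last N) ((S ∪ S.biUnion (fun i => nbr G i)).map Fin.castSuccEmb) := by
    have hu' : u ∈ S ∨ ∃ i ∈ S, G.Adj i u := huv.imp_right fun h => ⟨v, h, he.symm⟩
    have hv' : v ∈ S ∨ ∃ i ∈ S, G.Adj i v := huv.symm.imp_right fun h => ⟨u, h, he⟩
    intro j hj
    simp only [mem_union, mem_biUnion, mem_map, mem_insert, nbr, mem_filter, mem_univ, true_and,
      subdiv, SimpleGraph.fromRel_adj, Fin.castSuccEmb_apply] at hj ⊢
    rcases hj with (rfl | ⟨i, hi, rfl⟩) | ⟨k, hk, -, hadj⟩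
    · exact Or.inl rfl
    · exact Or.inr ⟨i, Or.inl hi, rfl⟩
    · rcases hadj with (⟨a, b, rfl, rfl, hab, -⟩ | ⟨-, hj⟩ | ⟨-, hj⟩) |
        (⟨a, b, rfl, rfl, hab, -⟩ | ⟨hj, -⟩ | ⟨hj, -⟩)
      · rcases hk with hk | ⟨i, hi, hk⟩
        · exact absurd hk (Fin.castSucc_ne_last a)
        · obtain rfl := Fin.castSucc_injective _ hk
          exact Or.inr ⟨b, Or.inr ⟨i, hi, hab⟩, rfl⟩
      · exact Or.inl hj
      · exact Or.inl hj
      · rcases hk with hk | ⟨i, hi, hk⟩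
        · exact absurd hk (Fin.castSucc_ne_last b)
        · obtain rfl := Fin.castSucc_injective _ hk
          exact Or.inr ⟨a, Or.inr ⟨i, hi, hab.symm⟩, rfl⟩
      · exact Or.inr ⟨u, hu', hj.symm⟩
      · exact Or.inr ⟨v, hv', hj.symm⟩
  have hcard := (Finset.card_le_card hsub).trans (Finset.card_insert_le _ _)
  rw [Finset.card_map] at hcard
  change _ + ∑ i ∈ S, d i.castSucc < _ at h
  omega

/-- Let `G` be `2`-connected on `[N]` with an edge `e = uv` such that `deg_G(u) = 2`, and let
`d = (d_1, …, d_{N+1})` be `D(G:e)`-draconian. If `d_{N+1} = 1` then `(d_1, …, d_N)` is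
`D(G)`-draconian; if `d_{N+1} = 2` then the sequence obtained from `(d_1, …, d_N)` by
increasing the entry `d u` by `1` is `D(G)`-draconian. -/
theorem draconian_of_subdiv_draconian {N : ℕ} (G : SimpleGraph (Fin N)) (h2 : TwoConnected G)
    (u v : Fin N) (he : G.Adj u v) (hdeg : (nbr G u).card = 2)
    (d : Fin (N + 1) → ℕ) (hd : draconian (subdiv G u v) d) :
    (d (Fin.last N) = 1 → draconian G (Fin.init d)) ∧
    (d (Fin.last N) = 2 →
      draconian G (Function.update (Fin.init d) u (Fin.init d u + 1))) := by
  have hsum := hd.1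
  rw [Fin.sum_univ_castSucc] at hsum
  have hN := h2.1
  have hle {S : Finset (Fin N)} (h : u ∈ S ∨ v ∈ S) := sum_castSucc_add_last_le_of_mem he hd h
  have hlt {S : Finset (Fin N)} (hS : S.Nonempty) (h : ¬(u ∈ S ∨ v ∈ S)) :=
    sum_castSucc_lt_of_notMem hd hS (fun h' => h (Or.inl h')) (fun h' => h (Or.inr h'))
  refine ⟨fun h1 => ⟨?_, fun S hS => ?_⟩, fun h2' => ⟨?_, fun S hS => ?_⟩⟩
  · simp only [Fin.init]
    omega
  · simp only [Fin.init]
    by_cases h : u ∈ S ∨ v ∈ S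
    · have := hle h
      omega
    · exact hlt hS h
  · rw [Finset.sum_update_of_mem (mem_univ u)]
    have := Finset.add_sum_erase univ (Fin.init d) (mem_univ u)
    rw [← Finset.sdiff_singleton_eq_erase] at this
    simp only [Fin.init] at this ⊢
    omega
  · by_cases h : u ∈ S ∨ v ∈ S
    · have hS' := hle h
      by_cases hu : u ∈ S
      · rw [Finset.sum_update_of_mem hu]
        have := Finset.add_sum_erase S (Fin.init d) hu
        rw [← Finset.sdiff_singleton_eq_erase] at this
        simp only [Fin.init] at this ⊢
        omega
      · rw [Finset.sum_update_of_notMem hu]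
        simp only [Fin.init]
        omega
    · rw [Finset.sum_update_of_notMem fun hu => h (Or.inl hu)]
      exact hlt hS h
end

section
/- For every integer N ≥ 4, the binomial identity ∑_{k=0}^{N−1} (k+1)·[(N−2)·binom(N−3, k) + binom(N−2, k−1)] = 2^{N−4}·(N²−N+6) holds, where binom(N−2, −1) is interpreted as 0 (i.e., the k = 0 summand contributes only (N−2)·binom(N−3,0)) and binom(m, k) = 0 whenever k > m. -/
theorem sum_range_mul_choose_succ (n : ℕ) :
    ∑ k ∈ Finset.range (n + 2), k * (n + 1).choose k = (n + 1) * 2 ^ n := by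
  rw [Finset.sum_range_succ', ← Nat.sum_range_choose, Finset.mul_sum]
  simp only [zero_mul, add_zero]
  exact Finset.sum_congr rfl fun k _ => by rw [Nat.add_one_mul_choose_eq, mul_comm]

theorem sum_range_add_mul_choose_succ (n c : ℕ) :
    ∑ k ∈ Finset.range (n + 2), (k + c) * (n + 1).choose k = (n + 1 + 2 * c) * 2 ^ n := by
  simp only [add_mul, Finset.sum_add_distrib, ← Finset.mul_sum, sum_range_mul_choose_succ,
    Nat.sum_range_choose]
  ring

/-- For every `N ≥ 4`,
`∑_{k=0}^{N-1} (k+1)·[(N-2)·binom(N-3,k) + binom(N-2,k-1)] = 2^{N-4}·(N²-N+6)`,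
where `binom(N-2, -1)` is interpreted as `0`. -/
theorem binomial_identity_K2N {N : ℕ} (hN : 4 ≤ N) :
    ∑ k ∈ Finset.range N,
        (k + 1) * ((N - 2) * Nat.choose (N - 3) k +
          if k = 0 then 0 else Nat.choose (N - 2) (k - 1)) =
      2 ^ (N - 4) * (N ^ 2 - N + 6) := by
  obtain ⟨n, rfl⟩ := Nat.exists_eq_add_of_le' hN
  have hsq : (n + 4) ^ 2 - (n + 4) = n ^ 2 + 7 * n + 12 := by
    apply Nat.sub_eq_of_eq_add
    ring
  have hleft : ∑ k ∈ Finset.range (n + 4), (k + 1) * ((n + 2) * (n + 1).choose k) =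
      (n + 2) * ((n + 3) * 2 ^ n) := by
    rw [Finset.sum_range_succ, Finset.sum_range_succ, Nat.choose_eq_zero_of_lt (by omega),
      Nat.choose_eq_zero_of_lt (by omega)]
    simp only [mul_left_comm _ (n + 2), ← Finset.mul_sum, sum_range_add_mul_choose_succ]
    ring
  have hright : ∑ k ∈ Finset.range (n + 4),
      (k + 1) * (if k = 0 then 0 else (n + 2).choose (k - 1)) = (n + 6) * 2 ^ (n + 1) := by
    rw [Finset.sum_range_succ']
    simpa [add_assoc] using sum_range_add_mul_choose_succ (n + 1) 2
  rw [hsq, show n + 4 - 2 = n + 2 from rfl, show n + 4 - 3 = n + 1 from rfl,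
    Nat.add_sub_cancel]
  simp only [mul_add, Finset.sum_add_distrib] at hleft hright ⊢
  rw [hleft, hright]
  ring
end
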